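/- arXiv:1804.01086 — 2 statements merged into one kernel-verified Lean document; each statement's English description precedes it below -/
import Mathlib

section
/- Let q ≥ 2 be a prime power, n ≥ 5 an odd integer, and α an integer with 0 ≤ α ≤ q²−2. Set n₁ = 1 + α(qⁿ+1) and n₂ = 1 + (q²−2)(qⁿ+1) + qⁿ − 2q³ + 1 − (1 + α(qⁿ+1)) (so n₂ = (q²−2−α)(qⁿ+1) + qⁿ − 2q³ + 1). Then for every integer t with 0 ≤ t ≤ qⁿ, at least one of the following holds: (i) V(t) := ⌊(n₁+t)/(qⁿ+1)⌋ + ⌊(n₂−q³t)/(qⁿ+1)⌋ + (q−1)⌊t/(qⁿ+1)⌋ + (q²−q)⌊t(q+1)/(qⁿ+1)⌋ < 0; (ii) ⌊(n₁+t)/(qⁿ+1)⌋ = ⌊(n₁−1+t)/(qⁿ+1)⌋ and ⌊(n₂−q³t)/(qⁿ+1)⌋ = ⌊(n₂−1−q³t)/(qⁿ+1)⌋. (This is the arithmetic criterion expressing that the pair is a pure gap at the pair of places consisting of a totally ramified zero of x^q+x and the place P_∞ of the GGS curve.) -/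
theorem ggs_div_eq (a m k r : ℤ) (h : a = k * m + r) (h0 : 0 ≤ r) (h1 : r < m) : a / m = k := by
  have hm : 0 < m := by linarith
  rw [h, add_comm, Int.add_mul_ediv_right _ _ hm.ne', Int.ediv_eq_zero_of_lt h0 h1, zero_add]

/-- Arithmetic floor criterion expressing that
`(n₁, n₂) = (1+α(qⁿ+1), (q²−2−α)(qⁿ+1)+qⁿ−2q³+1)` is a pure gap at the pair of
places consisting of a totally ramified zero of `x^q+x` and the place `P_∞` of the
GGS curve. -/
theorem ggs_pure_gap_infinity (q : ℤ) (n : ℕ) (α n₁ n₂ : ℤ)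
    (hq : 2 ≤ q) (hq' : IsPrimePow q)
    (hn5 : 5 ≤ n) (hnodd : Odd n)
    (hα : 0 ≤ α ∧ α ≤ q ^ 2 - 2)
    (hn₁ : n₁ = 1 + α * (q ^ n + 1))
    (hn₂ : n₂ = 1 + (q ^ 2 - 2) * (q ^ n + 1) + q ^ n - 2 * q ^ 3 + 1
      - (1 + α * (q ^ n + 1))) :
    ∀ t : ℤ, 0 ≤ t → t ≤ q ^ n →
      ((n₁ + t) / (q ^ n + 1) + (n₂ - q ^ 3 * t) / (q ^ n + 1)
          + (q - 1) * (t / (q ^ n + 1))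
          + (q ^ 2 - q) * ((t * (q + 1)) / (q ^ n + 1)) < 0)
      ∨ ((n₁ + t) / (q ^ n + 1) = (n₁ - 1 + t) / (q ^ n + 1)
          ∧ (n₂ - q ^ 3 * t) / (q ^ n + 1) = (n₂ - 1 - q ^ 3 * t) / (q ^ n + 1)) := by
  intro t ht0 ht
  have hN : 4 * q ^ 3 ≤ q ^ n := by
    have h1 : q ^ 5 ≤ q ^ n := pow_le_pow_right₀ (by linarith) hn5
    have h2 : 0 < q ^ 3 := by positivity
    have h3 : 0 ≤ q ^ 3 * (q ^ 2 - 4) := mul_nonneg h2.le (by nlinarith)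
    have h4 : q ^ 3 * (q ^ 2 - 4) = q ^ 5 - 4 * q ^ 3 := by ring
    linarith
  have hq3 : 4 * q ≤ q ^ 3 := by nlinarith [mul_nonneg (by linarith : 0 ≤ q) (by nlinarith : 0 ≤ q ^ 2 - 4)]
  have hcop : IsCoprime (q ^ n + 1) (q ^ 3) := by
    apply IsCoprime.pow_right
    obtain ⟨k, rfl⟩ : ∃ k, n = k + 1 := ⟨n - 1, by omega⟩
    exact ⟨1, -q ^ k, by ring⟩
  obtain ⟨hα0, hα1⟩ := hα
  clear hn5 hnodd hq'
  generalize q ^ n = N at *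
  subst hn₁ hn₂
  by_cases hA : t = N
  · left
    subst hA
    rw [ggs_div_eq (1 + α * (t + 1) + t) (t + 1) (α + 1) 0 (by ring) (by linarith) (by linarith),
      ggs_div_eq _ (t + 1) (q ^ 2 - 2 - α - q ^ 3) (t + 1 - q ^ 3) (by ring) (by linarith) (by linarith),
      ggs_div_eq t (t + 1) 0 t (by ring) (by linarith) (by linarith),
      ggs_div_eq (t * (q + 1)) (t + 1) q (t - q) (by ring) (by linarith) (by linarith)]
    nlinarith
  by_cases hB : t = N - 1
  · left
    obtain rfl : N = t + 1 := by linarith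
    rw [ggs_div_eq (1 + α * (t + 1 + 1) + t) (t + 1 + 1) α (t + 1) (by ring) (by linarith) (by linarith),
      ggs_div_eq _ (t + 1 + 1) (q ^ 2 - 1 - α - q ^ 3) 0 (by ring) (by linarith) (by linarith),
      ggs_div_eq t (t + 1 + 1) 0 t (by ring) (by linarith) (by linarith),
      ggs_div_eq (t * (q + 1)) (t + 1 + 1) q (t - 2 * q) (by ring) (by linarith) (by linarith)]
    nlinarith
  right
  have ht2 : t + 2 ≤ N := by omega
  constructor
  · rw [ggs_div_eq _ (N + 1) α (t + 1) (by ring) (by linarith) (by linarith),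
      ggs_div_eq _ (N + 1) α t (by ring) (by linarith) (by linarith)]
  · set x := 1 + (q ^ 2 - 2) * (N + 1) + N - 2 * q ^ 3 + 1 - (1 + α * (N + 1)) - q ^ 3 * t with hx
    have hm : 0 < N + 1 := by linarith
    have hr0 := Int.emod_nonneg x hm.ne'
    have hr1 := Int.emod_lt_of_pos x hm
    have hd := Int.emod_add_mul_ediv x (N + 1)
    have hne : x % (N + 1) ≠ 0 := by
      intro h0
      have h1 : (N + 1) ∣ x := Int.dvd_of_emod_eq_zero h0
      have h2 : (N + 1) ∣ q ^ 3 * (t + 2) := by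
        have h3 : q ^ 3 * (t + 2) = (q ^ 2 - 1 - α) * (N + 1) - x := by rw [hx]; ring
        rw [h3]
        exact dvd_sub (dvd_mul_left _ _) h1
      have h4 := Int.le_of_dvd (by linarith) (hcop.dvd_of_dvd_mul_left h2)
      linarith
    symm
    refine ggs_div_eq _ _ _ (x % (N + 1) - 1) ?_ (by omega) (by omega)
    linarith
end

section
/- Let n ≥ 2 be an integer, q₀ = 2ⁿ (so q₀ > 2), q = 2q₀², and g = q₀(q−1). Then max{n₁ + n₂ : (n₁,n₂) ∈ PG} = 2g − q; that is, every pair (n₁,n₂) ∈ PG satisfies n₁ + n₂ ≤ 2g − q, and there exists a pair in PG with n₁ + n₂ = 2g − q. (Since PG equals the set of pure gaps at any two distinct rational places of the Suzuki curve, this determines the maximal sum of a pure gap pair.) -/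
/-- The Weierstrass semigroup at a rational place of the Suzuki curve with
parameter `q₀` (so `q = 2q₀²`): the additive submonoid of `ℕ` generated by
`q, q+q₀, q+2q₀, q+2q₀+1`. -/
def suzukiH (q₀ : ℕ) : AddSubmonoid ℕ :=
  AddSubmonoid.closure
    ({2 * q₀ ^ 2, 2 * q₀ ^ 2 + q₀, 2 * q₀ ^ 2 + 2 * q₀, 2 * q₀ ^ 2 + 2 * q₀ + 1} : Set ℕ)

/-- For a gap `m`, write `m = r(q+2q₀+1) + m'q₀ + s` with `0 ≤ s ≤ q₀−1`;
`suzukiJ q₀ m` is `s + q₀` if `s ≤ ⌊(m'−1)/2⌋ + 1` (floor division in `ℤ`), and `s`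
otherwise. -/
def suzukiJ (q₀ m : ℕ) : ℤ :=
  let s : ℤ := ((m % (2 * q₀ ^ 2 + 2 * q₀ + 1)) % q₀ : ℕ)
  let m' : ℤ := ((m % (2 * q₀ ^ 2 + 2 * q₀ + 1)) / q₀ : ℕ)
  if s ≤ (m' - 1) / 2 + 1 then s + (q₀ : ℤ) else s

/-- Matthews' bijection `β(m) = 2g − 1 + q − (q−1)j(m) − m` for the Suzuki curve,
where `g = q₀(q−1)` and `q = 2q₀²`. -/
def suzukiBeta (q₀ m : ℕ) : ℤ :=
  2 * ((q₀ : ℤ) * (2 * (q₀ : ℤ) ^ 2 - 1)) - 1 + 2 * (q₀ : ℤ) ^ 2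
    - (2 * (q₀ : ℤ) ^ 2 - 1) * suzukiJ q₀ m - (m : ℤ)

/-- The set of pure gap pairs at two distinct rational places of the Suzuki curve:
`(n₁,n₂)` with `n₁, n₂` gaps, `n₂ < β(n₁)` and `n₁ < β(n₂)`. -/
def suzukiPG (q₀ : ℕ) : Set (ℕ × ℕ) :=
  {p | p.1 ∉ suzukiH q₀ ∧ p.2 ∉ suzukiH q₀ ∧
       (p.2 : ℤ) < suzukiBeta q₀ p.1 ∧ (p.1 : ℤ) < suzukiBeta q₀ p.2}

lemma suzukiH_form (a m : ℕ) (h : m ∈ suzukiH a) :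
    ∃ k t b : ℕ, m = k * (2 * a ^ 2) + a * t + b ∧ 2 * b ≤ t ∧ t ≤ 2 * k := by
  unfold suzukiH at h
  induction h using AddSubmonoid.closure_induction with
  | mem x hx =>
    rcases hx with h | h | h | h
    · exact ⟨1, 0, 0, by rw [h]; ring, by omega, by omega⟩
    · exact ⟨1, 1, 0, by rw [h]; ring, by omega, by omega⟩
    · exact ⟨1, 2, 0, by rw [h]; ring, by omega, by omega⟩
    · exact ⟨1, 2, 1, by rw [h]; ring, by omega, by omega⟩
  | zero => exact ⟨0, 0, 0, by simp, by omega, by omega⟩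
  | add x y _ _ hx hy =>
    obtain ⟨k, t, b, h1, h2, h3⟩ := hx
    obtain ⟨k', t', b', h1', h2', h3'⟩ := hy
    exact ⟨k + k', t + t', b + b', by rw [h1, h1']; ring, by omega, by omega⟩

lemma small_gap (a : ℕ) (ha : 4 ≤ a) : 2 * a + 2 ∉ suzukiH a := by
  intro h
  obtain ⟨k, t, b, h1, h2, h3⟩ := suzukiH_form a _ h
  rcases Nat.eq_zero_or_pos k with rfl | hk
  · obtain rfl : t = 0 := by omega
    obtain rfl : b = 0 := by omega
    simp at h1
  · nlinarith [Nat.zero_le (a * t), Nat.mul_le_mul hk (le_refl (2 * a ^ 2))]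

lemma big_gap (a r : ℕ) (ha : 4 ≤ a) (hr : r + 3 = 2 * a) :
    r * (2 * a ^ 2 + 2 * a + 1) + 1 ∉ suzukiH a := by
  intro h
  obtain ⟨k, t, b, h1, h2, h3⟩ := suzukiH_form a _ h
  have hk1 : r < k := by
    by_contra! hk
    have e1 : k * (2 * a ^ 2) ≤ r * (2 * a ^ 2) := Nat.mul_le_mul_right _ hk
    have e2 : a * t ≤ a * (2 * r) := Nat.mul_le_mul_left _ (by omega)
    have e3 : b ≤ r := by omega
    nlinarith
  have hk2 : k < r + 2 := by
    by_contra! hk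
    have e1 : (r + 2) * (2 * a ^ 2) ≤ k * (2 * a ^ 2) := Nat.mul_le_mul_right _ hk
    nlinarith [Nat.zero_le (a * t)]
  obtain rfl : k = r + 1 := by omega
  have e : (b : ℤ) = a * (2 * a - 4 - t) - 2 := by
    zify at h1 hr
    have hr' : (r : ℤ) = 2 * a - 3 := by linarith
    rw [hr'] at h1
    linarith
  have ht : (t : ℤ) ≤ 2 * a - 5 := by
    by_contra! ht
    nlinarith
  have : (2 : ℤ) * b ≤ t := by exact_mod_cast h2
  nlinarith

lemma suzukiJ_cases (a m : ℕ) (ha : 4 ≤ a) :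
    2 ≤ suzukiJ a m ∨ (suzukiJ a m = 1 ∧ m % (2 * a ^ 2 + 2 * a + 1) = 1) := by
  have hd := Nat.div_add_mod (m % (2 * a ^ 2 + 2 * a + 1)) a
  unfold suzukiJ
  simp only
  generalize m % (2 * a ^ 2 + 2 * a + 1) = u at *
  generalize u / a = d at *
  generalize u % a = s at *
  split_ifs with h
  · left; omega
  · by_cases h2 : 2 ≤ s
    · left; omega
    · right
      obtain rfl : d = 0 := by omega
      simp only [mul_zero, zero_add] at hd
      omega

lemma beta_le (a m x : ℕ) (ha : 4 ≤ a) (h : (x : ℤ) < suzukiBeta a m) :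
    (x : ℤ) + m ≤ 2 * ((a : ℤ) * (2 * (a : ℤ) ^ 2 - 1)) - 2 * (a : ℤ) ^ 2 ∨
    ((x : ℤ) + m ≤ 2 * ((a : ℤ) * (2 * (a : ℤ) ^ 2 - 1)) - 1 ∧
      m % (2 * a ^ 2 + 2 * a + 1) = 1) := by
  unfold suzukiBeta at h
  have ha' : (4 : ℤ) ≤ a := by exact_mod_cast ha
  rcases suzukiJ_cases a m ha with hj | ⟨hj, hm⟩
  · left
    have := mul_le_mul_of_nonneg_left hj (show (0 : ℤ) ≤ 2 * (a : ℤ) ^ 2 - 1 by nlinarith)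
    linarith
  · right
    rw [hj] at h
    exact ⟨by linarith, hm⟩

lemma upper (a x y : ℕ) (ha : 4 ≤ a) (h1 : (y : ℤ) < suzukiBeta a x)
    (h2 : (x : ℤ) < suzukiBeta a y) :
    (x : ℤ) + y ≤ 2 * ((a : ℤ) * (2 * (a : ℤ) ^ 2 - 1)) - 2 * (a : ℤ) ^ 2 := by
  rcases beta_le a x y ha h1 with h | ⟨hs, hx⟩
  · linarith
  rcases beta_le a y x ha h2 with h | ⟨_, hy⟩
  · linarith
  have ex := Nat.div_add_mod x (2 * a ^ 2 + 2 * a + 1)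
  have ey := Nat.div_add_mod y (2 * a ^ 2 + 2 * a + 1)
  rw [hx] at ex
  rw [hy] at ey
  generalize x / (2 * a ^ 2 + 2 * a + 1) = r at *
  generalize y / (2 * a ^ 2 + 2 * a + 1) = r' at *
  zify at ex ey ha
  have hsum : (x : ℤ) + y = (2 * (a : ℤ) ^ 2 + 2 * a + 1) * (r + r') + 2 := by
    rw [← ex, ← ey]; ring
  have hR : (r : ℤ) + r' ≤ 2 * a - 3 := by
    by_contra! hc
    have := mul_le_mul_of_nonneg_left (show (2 * a - 2 : ℤ) ≤ r + r' by omega)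
      (show (0 : ℤ) ≤ 2 * (a : ℤ) ^ 2 + 2 * a + 1 by positivity)
    nlinarith
  have := mul_le_mul_of_nonneg_left hR
      (show (0 : ℤ) ≤ 2 * (a : ℤ) ^ 2 + 2 * a + 1 by positivity)
  nlinarith

lemma j_small (a : ℕ) (ha : 4 ≤ a) : suzukiJ a (2 * a + 2) = 2 := by
  have e0 : (2 * a + 2) % (2 * a ^ 2 + 2 * a + 1) = 2 * a + 2 :=
    Nat.mod_eq_of_lt (by nlinarith)
  have e1 : (2 * a + 2) % a = 2 := by
    rw [Nat.mul_add_mod_self_right]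
    exact Nat.mod_eq_of_lt (by omega)
  have e2 : (2 * a + 2) / a = 2 := by
    rw [Nat.div_eq_iff (by omega)]; omega
  unfold suzukiJ
  simp only [e0, e1, e2]
  norm_num

lemma j_big (a r : ℕ) (ha : 4 ≤ a) :
    suzukiJ a (r * (2 * a ^ 2 + 2 * a + 1) + 1) = 1 := by
  have e0 : (r * (2 * a ^ 2 + 2 * a + 1) + 1) % (2 * a ^ 2 + 2 * a + 1) = 1 := by
    rw [Nat.mul_add_mod_self_right]
    exact Nat.mod_eq_of_lt (by nlinarith)
  have e1 : 1 % a = 1 := Nat.mod_eq_of_lt (by omega)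
  have e2 : 1 / a = 0 := Nat.div_eq_of_lt (by omega)
  unfold suzukiJ
  simp only [e0, e1, e2]
  norm_num

/-- For `q₀ = 2ⁿ > 2`, `q = 2q₀²` and `g = q₀(q−1)`, the maximum of `n₁ + n₂` over
pure gap pairs `(n₁,n₂)` at two distinct rational places of the Suzuki curve equals
`2g − q`. -/
theorem suzuki_max_pure_gap_sum (n q₀ q g : ℕ)
    (hn : 2 ≤ n) (hq₀ : q₀ = 2 ^ n) (hq : q = 2 * q₀ ^ 2) (hg : g = q₀ * (q - 1)) :
    (∀ p ∈ suzukiPG q₀, (p.1 : ℤ) + (p.2 : ℤ) ≤ 2 * (g : ℤ) - q) ∧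
    (∃ p ∈ suzukiPG q₀, (p.1 : ℤ) + (p.2 : ℤ) = 2 * (g : ℤ) - q) := by
  have ha : 4 ≤ q₀ := by
    rw [hq₀]
    calc 4 = 2 ^ 2 := by norm_num
      _ ≤ 2 ^ n := Nat.pow_le_pow_right (by norm_num) hn
  have hq1 : 1 ≤ q := by rw [hq]; nlinarith
  have hgz : (g : ℤ) = q₀ * (2 * (q₀ : ℤ) ^ 2 - 1) := by
    rw [hg]; push_cast [Nat.cast_sub hq1]; rw [hq]; push_cast; ring
  have hqz : (q : ℤ) = 2 * (q₀ : ℤ) ^ 2 := by rw [hq]; push_cast; ring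
  rw [hgz, hqz]
  clear hq₀ hgz hqz hg hq
  constructor
  · rintro ⟨x, y⟩ ⟨-, -, h1, h2⟩
    exact upper q₀ x y ha h1 h2
  · obtain ⟨r, hr⟩ : ∃ r, r + 3 = 2 * q₀ := ⟨2 * q₀ - 3, by omega⟩
    have hr' : (r : ℤ) = 2 * q₀ - 3 := by omega
    have ha' : (4 : ℤ) ≤ q₀ := by exact_mod_cast ha
    refine ⟨(r * (2 * q₀ ^ 2 + 2 * q₀ + 1) + 1, 2 * q₀ + 2),
      ⟨big_gap q₀ r ha hr, small_gap q₀ ha, ?_, ?_⟩, ?_⟩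
    · simp only [suzukiBeta, j_big q₀ r ha]
      push_cast
      rw [hr']
      nlinarith
    · simp only [suzukiBeta, j_small q₀ ha]
      push_cast
      rw [hr']
      nlinarith
    · push_cast
      rw [hr']
      ring
end
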